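/- Let G be a finite simple very well-covered graph. Then for every local maximum stable set S of G, the subgraph of G induced by N[S] is a König-Egerváry graph. -/

import Mathlib

open Classical

variable {V : Type*} [Fintype V] [DecidableEq V]

/-- `S` is a stable (independent) set of vertices in `G`. -/
def IsStable (G : SimpleGraph V) (S : Finset V) : Prop :=
  ∀ ⦃x⦄, x ∈ S → ∀ ⦃y⦄, y ∈ S → ¬G.Adj x y

/-- The open neighborhood `N(S)`: vertices outside `S` having a neighbor in `S`. -/
noncomputable def nbhd (G : SimpleGraph V) (S : Finset V) : Finset V :=
  Finset.univ.filter fun v => v ∉ S ∧ ∃ u ∈ S, G.Adj u v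

/-- The closed neighborhood `N[S] = S ∪ N(S)`. -/
noncomputable def closedNbhd (G : SimpleGraph V) (S : Finset V) : Finset V :=
  S ∪ nbhd G S

/-- The stability (independence) number of the subgraph of `G` induced by `A`. -/
noncomputable def alphaOn (G : SimpleGraph V) (A : Finset V) : ℕ :=
  sSup {n | ∃ S ⊆ A, IsStable G S ∧ S.card = n}

/-- The stability (independence) number `α(G)`. -/
noncomputable def alpha (G : SimpleGraph V) : ℕ :=
  alphaOn G Finset.univ

/-- `S` is a maximum stable set of the subgraph of `G` induced by `N[S]`. -/
def IsLocalMaxStable (G : SimpleGraph V) (S : Finset V) : Prop :=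
  IsStable G S ∧ S.card = alphaOn G (closedNbhd G S)

/-- `Ψ(G)`: the family of all local maximum stable sets of `G`. -/
def Psi (G : SimpleGraph V) : Set (Finset V) :=
  {S | IsLocalMaxStable G S}

/-- A matching of `G`: a set of pairwise disjoint edges of `G`. -/
def IsGMatching (G : SimpleGraph V) (M : Finset (Sym2 V)) : Prop :=
  (∀ e ∈ M, e ∈ G.edgeSet) ∧
    ∀ e ∈ M, ∀ f ∈ M, e ≠ f → ∀ v : V, v ∈ e → v ∉ f

/-- A matching of `G` all of whose edges have both endpoints inside `A`,
i.e. a matching of the subgraph of `G` induced by `A`. -/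
def IsGMatchingOn (G : SimpleGraph V) (A : Finset V) (M : Finset (Sym2 V)) : Prop :=
  IsGMatching G M ∧ ∀ e ∈ M, ∀ v : V, v ∈ e → v ∈ A

/-- The matching number of the subgraph of `G` induced by `A`. -/
noncomputable def muOn (G : SimpleGraph V) (A : Finset V) : ℕ :=
  sSup {n | ∃ M, IsGMatchingOn G A M ∧ M.card = n}

/-- The matching number `μ(G)`. -/
noncomputable def mu (G : SimpleGraph V) : ℕ :=
  muOn G Finset.univ

/-- A maximum matching of `G`. -/
def IsMaximumGMatching (G : SimpleGraph V) (M : Finset (Sym2 V)) : Prop :=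
  IsGMatching G M ∧ M.card = mu G

/-- The matching `M` saturates the vertex `v`. -/
def MSaturates (M : Finset (Sym2 V)) (v : V) : Prop :=
  ∃ e ∈ M, v ∈ e

/-- A perfect matching of `G`: a matching saturating every vertex. -/
def IsPerfectGMatching (G : SimpleGraph V) (M : Finset (Sym2 V)) : Prop :=
  IsGMatching G M ∧ ∀ v : V, MSaturates M v

/-- The set of vertices saturated by `M`. -/
noncomputable def msupp (M : Finset (Sym2 V)) : Finset V :=
  Finset.univ.filter fun v => ∃ e ∈ M, v ∈ e

/-- `M` is a uniquely restricted matching: it is the unique perfect matching of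
the subgraph of `G` induced by the set of vertices saturated by `M`. -/
def UniquelyRestricted (G : SimpleGraph V) (M : Finset (Sym2 V)) : Prop :=
  IsGMatching G M ∧
    ∀ M' : Finset (Sym2 V), IsGMatchingOn G (msupp M) M' →
      (∀ v ∈ msupp M, MSaturates M' v) → M' = M

/-- Accessibility property of a set system. -/
def AccessibleFam (F : Set (Finset V)) : Prop :=
  ∀ X ∈ F, X ≠ ∅ → ∃ x ∈ X, X.erase x ∈ F

/-- Exchange property of a set system. -/
def ExchangeFam (F : Set (Finset V)) : Prop :=
  ∀ X ∈ F, ∀ Y ∈ F, X.card = Y.card + 1 → ∃ x ∈ X, x ∉ Y ∧ insert x Y ∈ F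

/-- A greedoid: a nonempty set system satisfying accessibility and exchange. -/
def IsGreedoidFam (F : Set (Finset V)) : Prop :=
  F.Nonempty ∧ AccessibleFam F ∧ ExchangeFam F

/-- A maximal stable set. -/
def IsMaximalStable (G : SimpleGraph V) (S : Finset V) : Prop :=
  IsStable G S ∧ ∀ T, IsStable G T → S ⊆ T → S = T

/-- `G` is well-covered: all maximal stable sets have the same cardinality. -/
def WellCovered (G : SimpleGraph V) : Prop :=
  ∀ S T, IsMaximalStable G S → IsMaximalStable G T → S.card = T.card

/-- `G` is very well-covered: well-covered, no isolated vertices, `|V| = 2α(G)`. -/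
def VeryWellCovered (G : SimpleGraph V) : Prop :=
  WellCovered G ∧ (∀ v : V, ∃ u, G.Adj v u) ∧ Fintype.card V = 2 * alpha G

/-- The subgraph of `G` induced by `A` is a König-Egerváry graph. -/
def KonigEgervaryOn (G : SimpleGraph V) (A : Finset V) : Prop :=
  alphaOn G A + muOn G A = A.card

/-- `G` is a König-Egerváry graph: `α(G) + μ(G) = |V(G)|`. -/
def KonigEgervary (G : SimpleGraph V) : Prop :=
  alpha G + mu G = Fintype.card V

/-- The cycle `c` is alternating with respect to `M`: of every two incident
edges of `c` exactly one belongs to `M`. -/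
def IsAlternatingCycle (G : SimpleGraph V) (M : Finset (Sym2 V)) {v : V}
    (c : G.Walk v v) : Prop :=
  c.IsCycle ∧ ∀ e ∈ c.edges, ∀ f ∈ c.edges, e ≠ f →
    (∃ u : V, u ∈ e ∧ u ∈ f) → (e ∈ M ↔ f ∉ M)

/-- `G` contains an `M`-alternating cycle. -/
def HasAlternatingCycle (G : SimpleGraph V) (M : Finset (Sym2 V)) : Prop :=
  ∃ (v : V) (c : G.Walk v v), IsAlternatingCycle G M c

/-- The cycle `c` is chordless: the subgraph induced by its vertices has no
edges other than the cycle edges. -/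
def ChordlessCycle (G : SimpleGraph V) {v : V} (c : G.Walk v v) : Prop :=
  ∀ x ∈ c.support, ∀ y ∈ c.support, G.Adj x y → s(x, y) ∈ c.edges

theorem IsStable.subset {G : SimpleGraph V} {S T : Finset V} (hT : IsStable G T) (h : S ⊆ T) :
    IsStable G S := fun _ hx _ hy => hT (h hx) (h hy)

theorem mem_nbhd {G : SimpleGraph V} {S : Finset V} {v : V} :
    v ∈ nbhd G S ↔ v ∉ S ∧ ∃ u ∈ S, G.Adj u v := by
  simp [nbhd]

theorem bddAbove_card_stable (G : SimpleGraph V) (A : Finset V) :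
    BddAbove {n | ∃ S ⊆ A, IsStable G S ∧ S.card = n} := by
  refine ⟨A.card, ?_⟩
  rintro n ⟨S, hS, -, rfl⟩
  exact Finset.card_le_card hS

theorem IsStable.card_le_alphaOn {G : SimpleGraph V} {A S : Finset V} (hS : IsStable G S)
    (h : S ⊆ A) : S.card ≤ alphaOn G A :=
  le_csSup (bddAbove_card_stable G A) ⟨S, h, hS, rfl⟩

theorem IsStable.card_le_alpha {G : SimpleGraph V} {S : Finset V} (hS : IsStable G S) :
    S.card ≤ alpha G :=
  hS.card_le_alphaOn (Finset.subset_univ S)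

theorem exists_isStable_card_eq_alpha (G : SimpleGraph V) :
    ∃ T, IsStable G T ∧ T.card = alpha G := by
  have hne : {n | ∃ S ⊆ Finset.univ, IsStable G S ∧ S.card = n}.Nonempty :=
    ⟨0, ∅, Finset.empty_subset _, fun x hx => by simp at hx, rfl⟩
  obtain ⟨T, -, hT, hc⟩ := Nat.sSup_mem hne (bddAbove_card_stable G Finset.univ)
  exact ⟨T, hT, hc⟩

theorem IsStable.exists_isMaximalStable {G : SimpleGraph V} {J : Finset V} (hJ : IsStable G J) :
    ∃ Q, J ⊆ Q ∧ IsMaximalStable G Q := by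
  obtain ⟨Q, hJQ, hQ⟩ := (Set.toFinite {Q : Finset V | IsStable G Q}).exists_le_maximal hJ
  exact ⟨Q, hJQ, hQ.prop, fun T hT h => hQ.eq_of_le hT h⟩

/-- In a well-covered graph every stable set extends to a maximum one. -/
theorem WellCovered.exists_maximum_superset {G : SimpleGraph V} (hG : WellCovered G)
    {J : Finset V} (hJ : IsStable G J) :
    ∃ Q, J ⊆ Q ∧ IsStable G Q ∧ Q.card = alpha G := by
  obtain ⟨Q, hJQ, hQ⟩ := hJ.exists_isMaximalStable
  obtain ⟨T, hT, hc⟩ := exists_isStable_card_eq_alpha G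
  refine ⟨Q, hJQ, hQ.1, hc ▸ hG Q T hQ ⟨hT, fun U hU h => ?_⟩⟩
  exact Finset.eq_of_subset_of_card_le h (hc ▸ hU.card_le_alpha)

/-- If `Q` is stable of maximum size, then a stable set `J` disjoint from `Q` has at least
`|J|` neighbors in `Q`. -/
theorem IsStable.card_le_card_filter_adj {G : SimpleGraph V} {Q J : Finset V}
    (hQ : IsStable G Q) (hc : Q.card = alpha G) (hJ : IsStable G J) (hd : Disjoint J Q) :
    J.card ≤ (Q.filter fun q => ∃ j ∈ J, G.Adj j q).card := by
  have hst : IsStable G (J ∪ Q.filter fun q => ¬∃ j ∈ J, G.Adj j q) := by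
    intro x hx y hy hxy
    simp only [Finset.mem_union, Finset.mem_filter] at hx hy
    rcases hx with hx | ⟨hx, hx'⟩ <;> rcases hy with hy | ⟨hy, hy'⟩
    · exact hJ hx hy hxy
    · exact hy' ⟨x, hx, hxy⟩
    · exact hx' ⟨y, hy, hxy.symm⟩
    · exact hQ hx hy hxy
  have h := hst.card_le_alpha
  rw [Finset.card_union_of_disjoint (hd.mono_right (Finset.filter_subset _ _)), ← hc] at h
  have := Finset.card_filter_add_card_filter_not (s := Q) (fun q => ∃ j ∈ J, G.Adj j q)
  omega

/-- In a well-covered graph without isolated vertices, a stable set `I` has at least `|I|`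
neighbors. -/
theorem WellCovered.card_le_card_nbhd {G : SimpleGraph V} (hG : WellCovered G)
    (hiso : ∀ v : V, ∃ u, G.Adj v u) {I : Finset V} (hI : IsStable G I) :
    I.card ≤ (nbhd G I).card := by
  obtain ⟨T, hIT, hT, hTc⟩ := hG.exists_maximum_superset hI
  clear hI
  induction I using Finset.strongInduction with
  | H I ih =>
    rcases I.eq_empty_or_nonempty with rfl | ⟨x, hx⟩
    · simp
    obtain ⟨y, hxy⟩ := hiso x
    have hst : IsStable G (insert y (T.filter fun t => ¬G.Adj y t)) := by
      intro a ha b hb hab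
      simp only [Finset.mem_insert, Finset.mem_filter] at ha hb
      rcases ha with rfl | ⟨ha, ha'⟩ <;> rcases hb with rfl | ⟨hb, hb'⟩
      · exact G.irrefl hab
      · exact hb' hab
      · exact ha' hab.symm
      · exact hT ha hb hab
    obtain ⟨Q, hsub, hQ, hQc⟩ := hG.exists_maximum_superset hst
    have hyQ : y ∈ Q := hsub (Finset.mem_insert_self _ _)
    have hTQ : ∀ t ∈ T, ¬G.Adj y t → t ∈ Q := fun t ht h =>
      hsub (Finset.mem_insert_of_mem (Finset.mem_filter.2 ⟨ht, h⟩))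
    set J := I.filter fun t => G.Adj y t with hJdef
    set K := I.filter fun t => ¬G.Adj y t with hKdef
    have hJI : J ⊆ I := Finset.filter_subset _ _
    have hKI : K ⊆ I := Finset.filter_subset _ _
    have hKlt : K ⊂ I := by
      refine Finset.filter_ssubset.2 ⟨x, hx, ?_⟩
      simpa using hxy.symm
    have hJQ : Disjoint J Q := by
      rw [Finset.disjoint_left]
      intro a ha haQ
      exact hQ hyQ haQ (Finset.mem_filter.1 ha).2
    have h1 := hQ.card_le_card_filter_adj hQc (hT.subset (hJI.trans hIT)) hJQ
    have h2 := ih K hKlt (hKI.trans hIT)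
    have hsplit : J.card + K.card = I.card :=
      Finset.card_filter_add_card_filter_not (s := I) (fun t => G.Adj y t)
    have hdisj : Disjoint (Q.filter fun q => ∃ j ∈ J, G.Adj j q) (nbhd G K) := by
      rw [Finset.disjoint_left]
      intro a ha haK
      obtain ⟨k, hk, hka⟩ := (mem_nbhd.1 haK).2
      exact hQ (hTQ k (hIT (hKI hk)) (Finset.mem_filter.1 hk).2) (Finset.mem_filter.1 ha).1 hka
    have hle : (Q.filter fun q => ∃ j ∈ J, G.Adj j q) ∪ nbhd G K ⊆ nbhd G I := by
      intro a ha
      have : ∃ u ∈ I, G.Adj u a := by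
        rcases Finset.mem_union.1 ha with ha | ha
        · obtain ⟨j, hj, hja⟩ := (Finset.mem_filter.1 ha).2
          exact ⟨j, hJI hj, hja⟩
        · obtain ⟨k, hk, hka⟩ := (mem_nbhd.1 ha).2
          exact ⟨k, hKI hk, hka⟩
      obtain ⟨u, hu, hua⟩ := this
      exact mem_nbhd.2 ⟨fun haI => hT (hIT hu) (hIT haI) hua, u, hu, hua⟩
    have h3 := Finset.card_le_card hle
    rw [Finset.card_union_of_disjoint hdisj] at h3
    omega

/-- A very well-covered graph has a perfect matching, given here as a fixed-point-free
involution along edges. -/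
theorem VeryWellCovered.exists_involutive_adj {G : SimpleGraph V} (hG : VeryWellCovered G) :
    ∃ g : V → V, Function.Involutive g ∧ ∀ v, G.Adj v (g v) := by
  obtain ⟨hwc, hiso, hcard⟩ := hG
  obtain ⟨T, hT, hTc⟩ := exists_isStable_card_eq_alpha G
  obtain ⟨f, hfinj, hf⟩ := (Finset.all_card_le_biUnion_card_iff_exists_injective
    (fun t : T => nbhd G {t.1})).1 (by
      intro s
      have hsT : s.map (Function.Embedding.subtype _) ⊆ T := by
        intro a ha
        obtain ⟨b, -, rfl⟩ := Finset.mem_map.1 ha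
        exact b.2
      have h := hwc.card_le_card_nbhd hiso (hT.subset hsT)
      rw [Finset.card_map] at h
      refine h.trans (Finset.card_le_card fun a ha => ?_)
      obtain ⟨-, u, hu, hua⟩ := mem_nbhd.1 ha
      obtain ⟨b, hb, rfl⟩ := Finset.mem_map.1 hu
      refine Finset.mem_biUnion.2 ⟨b, hb, mem_nbhd.2 ⟨?_, b, by simp, hua⟩⟩
      simpa using hua.ne')
  have hadj : ∀ t : T, G.Adj t.1 (f t) := fun t => by
    obtain ⟨-, u, hu, h⟩ := mem_nbhd.1 (hf t)
    rwa [Finset.mem_singleton.1 hu] at h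
  have hfT : ∀ t, f t ∉ T := fun t h => hT t.2 h (hadj t)
  have himg : Finset.univ.image f = Tᶜ := by
    refine Finset.eq_of_subset_of_card_le (fun a ha => ?_) ?_
    · obtain ⟨t, -, rfl⟩ := Finset.mem_image.1 ha
      exact Finset.mem_compl.2 (hfT t)
    · rw [Finset.card_image_of_injective _ hfinj, Finset.card_compl, Finset.card_univ,
        Fintype.card_coe]
      omega
  have hsurj : ∀ v : V, v ∉ T → ∃ t : T, f t = v := fun v hv => by
    have : v ∈ Finset.univ.image f := himg ▸ Finset.mem_compl.2 hv
    simpa using this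
  choose k hk using hsurj
  refine ⟨fun v => if h : v ∈ T then f ⟨v, h⟩ else k v h, fun v => ?_, fun v => ?_⟩
  · by_cases h : v ∈ T
    · have h' := hfT ⟨v, h⟩
      simp only [h, h', dite_true, dite_false]
      exact congrArg Subtype.val (hfinj (hk _ h'))
    · simp [h, hk]
  · by_cases h : v ∈ T
    · simpa [h] using hadj ⟨v, h⟩
    · have := hadj (k v h)
      rw [hk] at this
      simpa [h] using this.symm

/-- For a perfect matching `g` of a very well-covered graph, every neighbor of `v` is adjacent
to every neighbor of the partner of `v`. -/
theorem VeryWellCovered.adj_of_adj_partner {G : SimpleGraph V} (hG : VeryWellCovered G)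
    {g : V → V} (hg : Function.Involutive g) (hadj : ∀ v, G.Adj v (g v)) {v a b : V}
    (ha : G.Adj a v) (hb : G.Adj b (g v)) : G.Adj a b := by
  by_contra hab
  have hst : IsStable G {a, b} := by
    intro x hx y hy hxy
    simp only [Finset.mem_insert, Finset.mem_singleton] at hx hy
    rcases hx with rfl | rfl <;> rcases hy with rfl | rfl
    · exact G.irrefl hxy
    · exact hab hxy
    · exact hab hxy.symm
    · exact G.irrefl hxy
  obtain ⟨Q, hsub, hQ, hQc⟩ := hG.1.exists_maximum_superset hst
  have hd : Disjoint Q (Q.image g) := by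
    rw [Finset.disjoint_left]
    intro x hx hx'
    obtain ⟨y, hy, rfl⟩ := Finset.mem_image.1 hx'
    exact hQ hy hx (hadj y)
  have huniv : Q ∪ Q.image g = Finset.univ := by
    rw [← Finset.card_eq_iff_eq_univ, Finset.card_union_of_disjoint hd,
      Finset.card_image_of_injective _ hg.injective, hG.2.2]
    omega
  have hv : v ∈ Q ∪ Q.image g := huniv ▸ Finset.mem_univ v
  rcases Finset.mem_union.1 hv with hv | hv
  · exact hQ (hsub (by simp)) hv ha
  · obtain ⟨y, hy, rfl⟩ := Finset.mem_image.1 hv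
    rw [hg y] at hb
    exact hQ (hsub (by simp)) hy hb

/-- A perfect matching of a very well-covered graph sends the neighborhood of a local maximum
stable set `S` into `S`. -/
theorem VeryWellCovered.partner_mem_of_mem_nbhd {G : SimpleGraph V} (hG : VeryWellCovered G)
    {g : V → V} (hg : Function.Involutive g) (hadj : ∀ v, G.Adj v (g v)) {S : Finset V}
    (hS : IsLocalMaxStable G S) {v : V} (hv : v ∈ nbhd G S) : g v ∈ S := by
  by_contra hgv
  obtain ⟨hst, hmax⟩ := hS
  have key : ∀ {w a b : V}, G.Adj a w → G.Adj b (g w) → G.Adj a b :=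
    fun ha hb => hG.adj_of_adj_partner hg hadj ha hb
  have hvS : v ∉ S := (mem_nbhd.1 hv).1
  have hgS : ∀ u ∈ S, g u ∉ S := fun u hu h => hst hu h (hadj u)
  set D := S.filter fun u => G.Adj v u with hD
  set E := S.filter fun u => ¬G.Adj v u with hE
  have hgg : ∀ u ∈ D, ∀ u' ∈ D, ¬G.Adj (g u) (g u') := fun u hu u' hu' h =>
    have h1 : G.Adj v (g u') := key (Finset.mem_filter.1 hu).2 h.symm
    G.irrefl (key (Finset.mem_filter.1 hu').2 h1)
  have hgv' : ∀ u ∈ D, ¬G.Adj v (g u) := fun u hu h =>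
    G.irrefl (key (Finset.mem_filter.1 hu).2 h)
  have hgE : ∀ u ∈ D, ∀ e ∈ E, ¬G.Adj e (g u) := fun u hu e he h =>
    (Finset.mem_filter.1 he).2 (key (Finset.mem_filter.1 hu).2 h)
  have hnew : IsStable G (insert v (D.image g ∪ E)) := by
    intro a ha b hb hab
    simp only [Finset.mem_insert, Finset.mem_union, Finset.mem_image] at ha hb
    rcases ha with rfl | ⟨u, hu, rfl⟩ | ha <;> rcases hb with rfl | ⟨u', hu', rfl⟩ | hb
    · exact G.irrefl hab
    · exact hgv' _ hu' hab
    · exact (Finset.mem_filter.1 hb).2 hab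
    · exact hgv' _ hu hab.symm
    · exact hgg _ hu _ hu' hab
    · exact hgE _ hu _ hb hab.symm
    · exact (Finset.mem_filter.1 ha).2 hab.symm
    · exact hgE _ hu' _ ha hab
    · exact hst (Finset.mem_filter.1 ha).1 (Finset.mem_filter.1 hb).1 hab
  have hsub : insert v (D.image g ∪ E) ⊆ closedNbhd G S := by
    intro a ha
    simp only [Finset.mem_insert, Finset.mem_union, Finset.mem_image] at ha
    rcases ha with rfl | ⟨u, hu, rfl⟩ | ha
    · exact Finset.mem_union_right _ hv
    · have huS := (Finset.mem_filter.1 hu).1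
      exact Finset.mem_union_right _ (mem_nbhd.2 ⟨hgS u huS, u, huS, hadj u⟩)
    · exact Finset.mem_union_left _ (Finset.mem_filter.1 ha).1
  have hle := hnew.card_le_alphaOn hsub
  have hdis : Disjoint (D.image g) E := by
    rw [Finset.disjoint_left]
    intro a ha haE
    obtain ⟨u, hu, rfl⟩ := Finset.mem_image.1 ha
    exact hgS u (Finset.mem_filter.1 hu).1 (Finset.mem_filter.1 haE).1
  have hvn : v ∉ D.image g ∪ E := by
    simp only [Finset.mem_union, Finset.mem_image, not_or]
    refine ⟨?_, fun h => hvS (Finset.mem_filter.1 h).1⟩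
    rintro ⟨u, hu, rfl⟩
    exact hgv (by rw [hg u]; exact (Finset.mem_filter.1 hu).1)
  rw [Finset.card_insert_of_notMem hvn, Finset.card_union_of_disjoint hdis,
    Finset.card_image_of_injective _ hg.injective, ← hmax] at hle
  have : D.card + E.card = S.card :=
    Finset.card_filter_add_card_filter_not (s := S) (fun u => G.Adj v u)
  omega

/-- A matching of the subgraph induced by `N[S]`, with `S` stable, has at most `|N(S)|` edges. -/
theorem IsGMatchingOn.card_le_card_nbhd {G : SimpleGraph V} {S : Finset V} (hS : IsStable G S)
    {M : Finset (Sym2 V)} (hM : IsGMatchingOn G (closedNbhd G S) M) :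
    M.card ≤ (nbhd G S).card := by
  have hex : ∀ e ∈ M, ∃ v ∈ e, v ∈ nbhd G S := by
    intro e he
    induction e using Sym2.ind with
    | _ a b =>
      have hab : G.Adj a b := hM.1.1 _ he
      have ha := Finset.mem_union.1 (hM.2 _ he a (by simp))
      have hb := Finset.mem_union.1 (hM.2 _ he b (by simp))
      rcases ha with ha | ha
      · rcases hb with hb | hb
        · exact absurd hab (hS ha hb)
        · exact ⟨b, by simp, hb⟩
      · exact ⟨a, by simp, ha⟩
  choose p hp hpn using fun e : M => hex e e.2
  rw [← Fintype.card_coe M, ← Fintype.card_coe (nbhd G S)]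
  refine Fintype.card_le_of_injective (fun e => ⟨p e, hpn e⟩) fun e f hef => ?_
  have hpe : p e = p f := congrArg Subtype.val hef
  by_contra hne
  exact hM.1.2 e e.2 f f.2 (fun h => hne (Subtype.ext h)) (p e) (hp e) (hpe ▸ hp f)

/-- An involution along edges mapping `N(S)` into `S` yields a matching of the subgraph induced
by `N[S]` with `|N(S)|` edges. -/
theorem exists_isGMatchingOn_closedNbhd {G : SimpleGraph V} {S : Finset V} {g : V → V}
    (hg : Function.Involutive g) (hadj : ∀ v, G.Adj v (g v))
    (hmem : ∀ v ∈ nbhd G S, g v ∈ S) :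
    ∃ M, IsGMatchingOn G (closedNbhd G S) M ∧ M.card = (nbhd G S).card := by
  refine ⟨(nbhd G S).image fun v => s(v, g v), ⟨⟨?_, ?_⟩, ?_⟩, ?_⟩
  · intro e he
    obtain ⟨v, -, rfl⟩ := Finset.mem_image.1 he
    exact hadj v
  · intro e he f hf hne w hwe hwf
    obtain ⟨v, -, rfl⟩ := Finset.mem_image.1 he
    obtain ⟨u, -, rfl⟩ := Finset.mem_image.1 hf
    apply hne
    rcases Sym2.mem_iff.1 hwe with rfl | rfl <;> rcases Sym2.mem_iff.1 hwf with h | h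
    · rw [h]
    · rw [h, hg u, Sym2.eq_swap]
    · rw [← h, hg v, Sym2.eq_swap]
    · rw [hg.injective h]
  · intro e he w hw
    obtain ⟨v, hv, rfl⟩ := Finset.mem_image.1 he
    rcases Sym2.mem_iff.1 hw with rfl | rfl
    · exact Finset.mem_union_right _ hv
    · exact Finset.mem_union_left _ (hmem v hv)
  · refine Finset.card_image_of_injOn fun v hv u hu h => ?_
    rcases Sym2.eq_iff.1 h with ⟨h, -⟩ | ⟨h, -⟩
    · exact h
    · exact absurd (h ▸ hmem u hu) (mem_nbhd.1 hv).1

/-- For a very well-covered graph `G` and every `S ∈ Ψ(G)`, the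
subgraph induced by `N[S]` is a König-Egerváry graph. -/
theorem psi_closed_nbhd_konig_egervary (G : SimpleGraph V)
    (hG : VeryWellCovered G) (S : Finset V) (hS : S ∈ Psi G) :
    KonigEgervaryOn G (closedNbhd G S) := by
  obtain ⟨g, hg, hadj⟩ := hG.exists_involutive_adj
  obtain ⟨M, hM, hMc⟩ := exists_isGMatchingOn_closedNbhd hg hadj fun v hv =>
    hG.partner_mem_of_mem_nbhd hg hadj hS hv
  have hmu : muOn G (closedNbhd G S) = (nbhd G S).card := by
    refine IsGreatest.csSup_eq ⟨⟨M, hM, hMc⟩, ?_⟩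
    rintro n ⟨M', hM', rfl⟩
    exact hM'.card_le_card_nbhd hS.1
  have hdisj : Disjoint S (nbhd G S) :=
    Finset.disjoint_right.2 fun _ h => (mem_nbhd.1 h).1
  rw [KonigEgervaryOn, hmu, ← hS.2, closedNbhd, Finset.card_union_of_disjoint hdisj]
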